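/- Fix χ > 0 with a_2 := w_1 − Σ β_i m_i χ^{2(γ−r_i)} > 0 and 0 < δ < min{H_1, H_2}. Set c = min{c_0, c_2} (with c_0 = w_0 − 4hLδ^μ, c_2 = w_2 − 2Lδ^μ), b = max{b_1, b_2} (with b_1 = α_1 + 2h(Σ β_i m_i)δ^μ, b_2 = (w_1 + h w_2 + Σ β_i m_i)δ^μ), ρ_1 = (2 max{1,h})^{μ/γ} and ρ_2 = c/(ρ_1 b^{(γ+μ)/γ}). Then along every solution x(·) of ẋ(t) = f(x(t), x(t−h)) satisfying ‖x_t‖_H ≤ δ for all t ≥ 0, one has d/dt v(x_t) ≤ −ρ_2 · v(x_t)^{(γ+μ)/γ} for all t ≥ 0. -/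

import Mathlib

set_option linter.unusedVariables false

noncomputable def hnorm (n : ℕ) (r : Fin n → ℝ) (p : ℝ) (x : Fin n → ℝ) : ℝ :=
  (∑ i, |x i| ^ (p / r i)) ^ (1 / p)

noncomputable def pd (n : ℕ) (f : (Fin n → ℝ) → (Fin n → ℝ) → (Fin n → ℝ))
    (i j : Fin n) (x y : Fin n → ℝ) : ℝ :=
  deriv (fun t => f (Function.update x j t) y i) (x j)

noncomputable def vfun (n : ℕ) (r : Fin n → ℝ) (p h μ γ w1 w2 : ℝ)
    (f : (Fin n → ℝ) → (Fin n → ℝ) → (Fin n → ℝ)) (V : (Fin n → ℝ) → ℝ)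
    (φ : ℝ → Fin n → ℝ) : ℝ :=
  V (φ 0) + fderiv ℝ V (φ 0) (∫ θ in (-h)..(0:ℝ), f (φ 0) (φ θ))
    + ∫ θ in (-h)..(0:ℝ), (w1 + (h + θ) * w2) * hnorm n r p (φ θ) ^ (γ + μ)

noncomputable def segNorm (n : ℕ) (r : Fin n → ℝ) (p h : ℝ)
    (x : ℝ → Fin n → ℝ) (t : ℝ) : ℝ :=
  sSup ((fun θ => hnorm n r p (x (t + θ))) '' Set.Icc (-h) 0)

def IsSol (n : ℕ) (h : ℝ) (f : (Fin n → ℝ) → (Fin n → ℝ) → (Fin n → ℝ))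
    (x : ℝ → Fin n → ℝ) : Prop :=
  ContinuousOn x (Set.Ici (-h)) ∧
  ∀ t : ℝ, 0 ≤ t → HasDerivWithinAt x (f (x t) (x (t - h))) (Set.Ici 0) t

theorem hnorm_nonneg {n : ℕ} {r : Fin n → ℝ} {p : ℝ} (x : Fin n → ℝ) : 0 ≤ hnorm n r p x :=
  Real.rpow_nonneg (Finset.sum_nonneg fun _ _ => Real.rpow_nonneg (abs_nonneg _) _) _

theorem continuous_hnorm {n : ℕ} {r : Fin n → ℝ} (hr : ∀ i, 0 < r i) {p : ℝ} (hp : 0 < p) :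
    Continuous (hnorm n r p) := by
  unfold hnorm
  refine Continuous.rpow_const ?_ fun _ => Or.inr (one_div_nonneg.2 hp.le)
  refine continuous_finsetSum _ fun i _ => ?_
  exact ((continuous_apply i).abs).rpow_const fun _ => Or.inr (div_nonneg hp.le (hr i).le)

section Young

/-- A monomial is bounded by any upper bound for its variables. -/
theorem rpow_mul_rpow_mul_rpow_le_rpow {x y z M a b c : ℝ} (hx : 0 ≤ x) (hy : 0 ≤ y) (hz : 0 ≤ z)
    (hxM : x ≤ M) (hyM : y ≤ M) (hzM : z ≤ M) (ha : 0 ≤ a) (hb : 0 ≤ b) (hc : 0 ≤ c) :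
    x ^ a * y ^ b * z ^ c ≤ M ^ (a + b + c) := by
  have hM := hx.trans hxM
  rw [Real.rpow_add_of_nonneg hM (add_nonneg ha hb) hc, Real.rpow_add_of_nonneg hM ha hb]
  gcongr

theorem rpow_mul_rpow_mul_rpow_le {x y z δ a b c q e : ℝ} (hx : 0 ≤ x) (hy : 0 ≤ y) (hz : 0 ≤ z)
    (hxδ : x ≤ δ) (hyδ : y ≤ δ) (hzδ : z ≤ δ) (ha : 0 ≤ a) (hb : 0 ≤ b) (hc : 0 ≤ c)
    (hq : 0 ≤ q) (he : 0 ≤ e) (h : a + b + c = q + e) :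
    x ^ a * y ^ b * z ^ c ≤ δ ^ e * (x ^ q + y ^ q + z ^ q) := by
  have key : ∀ M, x ≤ M → y ≤ M → z ≤ M → M ≤ δ → M ^ q ≤ x ^ q + y ^ q + z ^ q →
      x ^ a * y ^ b * z ^ c ≤ δ ^ e * (x ^ q + y ^ q + z ^ q) := by
    intro M hxM hyM hzM hMδ hM
    have hM0 := hx.trans hxM
    have hδ := hM0.trans hMδ
    calc x ^ a * y ^ b * z ^ c ≤ M ^ (q + e) :=
          h ▸ rpow_mul_rpow_mul_rpow_le_rpow hx hy hz hxM hyM hzM ha hb hc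
      _ = M ^ e * M ^ q := by rw [Real.rpow_add_of_nonneg hM0 hq he, mul_comm]
      _ ≤ δ ^ e * (x ^ q + y ^ q + z ^ q) := by gcongr
  have hxq := Real.rpow_nonneg hx q
  have hyq := Real.rpow_nonneg hy q
  have hzq := Real.rpow_nonneg hz q
  rcases le_total x y with hxy | hxy <;> rcases le_total y z with hyz | hyz <;>
    rcases le_total x z with hxz | hxz
  · exact key z hxz hyz le_rfl hzδ (by linarith)
  · exact key z (hxy.trans hyz) hyz le_rfl hzδ (by linarith)
  · exact key y hxy le_rfl hyz hyδ (by linarith)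
  · exact key y hxy le_rfl hyz hyδ (by linarith)
  · exact key z hxz hyz le_rfl hzδ (by linarith)
  · exact key x le_rfl hxy hxz hxδ (by linarith)
  · exact key x le_rfl hxy (hyz.trans hxy) hxδ (by linarith)
  · exact key x le_rfl hxy hxz hxδ (by linarith)

theorem rpow_mul_rpow_le {x y δ a b q e : ℝ} (hx : 0 ≤ x) (hy : 0 ≤ y)
    (hxδ : x ≤ δ) (hyδ : y ≤ δ) (ha : 0 ≤ a) (hb : 0 ≤ b)
    (hq : 0 ≤ q) (he : 0 ≤ e) (h : a + b = q + e) :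
    x ^ a * y ^ b ≤ δ ^ e * (x ^ q + y ^ q) := by
  have hxq := Real.rpow_nonneg hx q
  have hyq := Real.rpow_nonneg hy q
  have key : ∀ M, x ≤ M → y ≤ M → M ≤ δ → M ^ q ≤ x ^ q + y ^ q →
      x ^ a * y ^ b ≤ δ ^ e * (x ^ q + y ^ q) := by
    intro M hxM hyM hMδ hM
    have hM0 := hx.trans hxM
    have hδ := hM0.trans hMδ
    calc x ^ a * y ^ b ≤ M ^ a * M ^ b := by gcongr
      _ = M ^ e * M ^ q := by
        rw [← Real.rpow_add_of_nonneg hM0 ha hb, h, Real.rpow_add_of_nonneg hM0 hq he, mul_comm]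
      _ ≤ δ ^ e * (x ^ q + y ^ q) := by gcongr
  rcases le_total x y with hxy | hxy
  · exact key y hxy le_rfl hyδ (by linarith)
  · exact key x le_rfl hxy hxδ (by linarith)

theorem rpow_le_rpow_mul_rpow {x δ q e : ℝ} (hx : 0 ≤ x) (hxδ : x ≤ δ) (hq : 0 ≤ q) (he : 0 ≤ e) :
    x ^ (q + e) ≤ δ ^ e * x ^ q := by
  rw [Real.rpow_add_of_nonneg hx hq he, mul_comm]
  gcongr

theorem rpow_mul_rpow_le_add {x y a b : ℝ} (hx : 0 ≤ x) (hy : 0 ≤ y) (ha : 0 ≤ a) (hb : 0 ≤ b) :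
    x ^ a * y ^ b ≤ x ^ (a + b) + y ^ (a + b) := by
  have := rpow_mul_rpow_le hx hy (le_max_left x y) (le_max_right x y) ha hb (add_nonneg ha hb)
    le_rfl (add_zero _).symm
  simpa using this

theorem rpow_mul_rpow_le_weighted {x y a b χ : ℝ} (hx : 0 ≤ x) (hy : 0 ≤ y) (ha : 0 < a)
    (hb : 0 < b) (hχ : 0 < χ) :
    x ^ a * y ^ b ≤ χ ^ (-2 * b) * x ^ (a + b) + χ ^ (2 * a) * y ^ (a + b) := by
  have hab : 0 < a + b := add_pos ha hb
  set k := 2 / (a + b) with hk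
  have hkab : k * (a + b) = 2 := div_mul_cancel₀ _ hab.ne'
  have h := rpow_mul_rpow_le_add (mul_nonneg (Real.rpow_nonneg hχ.le (-k * b)) hx)
    (mul_nonneg (Real.rpow_nonneg hχ.le (k * a)) hy) ha.le hb.le
  rw [Real.mul_rpow (by positivity) hx, Real.mul_rpow (by positivity) hy,
    Real.mul_rpow (by positivity) hx, Real.mul_rpow (by positivity) hy,
    ← Real.rpow_mul hχ.le, ← Real.rpow_mul hχ.le, ← Real.rpow_mul hχ.le, ← Real.rpow_mul hχ.le] at h
  have e1 : -k * b * (a + b) = -2 * b := by linear_combination (-b) * hkab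
  have e2 : k * a * (a + b) = 2 * a := by linear_combination a * hkab
  have e3 : χ ^ (-k * b * a) * χ ^ (k * a * b) = 1 := by
    rw [← Real.rpow_add hχ]
    ring_nf
    exact Real.rpow_zero _
  rw [e1, e2] at h
  calc x ^ a * y ^ b = χ ^ (-k * b * a) * χ ^ (k * a * b) * (x ^ a * y ^ b) := by rw [e3, one_mul]
    _ = χ ^ (-k * b * a) * x ^ a * (χ ^ (k * a * b) * y ^ b) := by ring
    _ ≤ _ := h

end Young

section PowerMean

theorem rpow_integral_le {g : ℝ → ℝ} (hg : Continuous g) (hg0 : ∀ s, 0 ≤ g s) {a h q : ℝ}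
    (hh : 0 < h) (hq : 1 ≤ q) :
    (∫ s in a - h..a, g s) ^ q ≤ h ^ (q - 1) * ∫ s in a - h..a, g s ^ q := by
  have hle : a - h ≤ a := by linarith
  have hgq : Continuous fun s => g s ^ q := hg.rpow_const fun _ => Or.inr (by linarith)
  have J := (convexOn_rpow hq).map_set_average_le (μ := MeasureTheory.volume)
    (t := Set.Ioc (a - h) a) (f := g)
    (Real.continuous_rpow_const (by linarith)).continuousOn isClosed_Ici
    (by simp [hh]) (by simp) (Filter.Eventually.of_forall fun s => hg0 s)
    ((intervalIntegrable_iff_integrableOn_Ioc_of_le hle).1 (hg.intervalIntegrable _ _))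
    ((intervalIntegrable_iff_integrableOn_Ioc_of_le hle).1 (hgq.intervalIntegrable _ _))
  have hI := intervalIntegral.integral_nonneg (μ := MeasureTheory.volume) hle fun s _ => hg0 s
  rw [← Set.uIoc_of_le hle, interval_average_eq, interval_average_eq, sub_sub_cancel, smul_eq_mul,
    smul_eq_mul, Real.mul_rpow (by positivity) hI, Real.inv_rpow hh.le] at J
  rw [Real.rpow_sub_one hh.ne']
  have hhq := Real.rpow_pos_of_pos hh q
  calc (∫ s in a - h..a, g s) ^ q = h ^ q * ((h ^ q)⁻¹ * (∫ s in a - h..a, g s) ^ q) := by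
        field_simp
    _ ≤ h ^ q * (h⁻¹ * ∫ s in a - h..a, g s ^ q) := by gcongr
    _ = _ := by ring

theorem add_rpow_le_mul_add_rpow {x y q : ℝ} (hx : 0 ≤ x) (hy : 0 ≤ y) (hq : 1 ≤ q) :
    (x + y) ^ q ≤ 2 ^ (q - 1) * (x ^ q + y ^ q) := by
  lift x to NNReal using hx
  lift y to NNReal using hy
  exact_mod_cast NNReal.rpow_add_le_mul_rpow_add_rpow x y hq

theorem add_integral_rpow_le {g : ℝ → ℝ} (hg : Continuous g) (hg0 : ∀ s, 0 ≤ g s) {x a h q : ℝ}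
    (hx : 0 ≤ x) (hh : 0 < h) (hq : 1 ≤ q) :
    (x + ∫ s in a - h..a, g s) ^ q ≤
      (2 * max 1 h) ^ (q - 1) * (x ^ q + ∫ s in a - h..a, g s ^ q) := by
  have hle : a - h ≤ a := by linarith
  have hI := intervalIntegral.integral_nonneg (μ := MeasureTheory.volume) hle fun s _ => hg0 s
  have hIq := intervalIntegral.integral_nonneg (μ := MeasureTheory.volume) hle
    fun s _ => Real.rpow_nonneg (hg0 s) q
  have hq1 : 0 ≤ q - 1 := by linarith
  rw [Real.mul_rpow (by norm_num) (by positivity), mul_assoc]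
  refine (add_rpow_le_mul_add_rpow hx hI hq).trans ?_
  gcongr
  rw [mul_add]
  refine add_le_add ?_ ((rpow_integral_le hg hg0 hh hq).trans ?_)
  · exact le_mul_of_one_le_left (Real.rpow_nonneg hx _)
      (Real.one_le_rpow (le_max_left _ _) hq1)
  · gcongr
    exact le_max_right _ _

end PowerMean

section ParametricIntegral

open MeasureTheory

variable {E F : Type*} [NormedAddCommGroup E] [NormedSpace ℝ E] [NormedAddCommGroup F]
  [NormedSpace ℝ F]

theorem norm_sub_le_of_fderiv_le {f : E → E → F} (hfd : ∀ y, Differentiable ℝ fun x => f x y)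
    {S T : Set E} (hS : Convex ℝ S) {K : ℝ}
    (hK : ∀ x ∈ S, ∀ y ∈ T, ‖fderiv ℝ (fun z => f z y) x‖ ≤ K)
    {x x' y : E} (hx : x ∈ S) (hx' : x' ∈ S) (hy : y ∈ T) :
    ‖f x' y - f x y‖ ≤ K * ‖x' - x‖ :=
  hS.norm_image_sub_le_of_norm_fderiv_le (f := fun z => f z y) (fun z _ => hfd y z)
    (fun z hz => hK z hz y hy) hx hx'

/-- On bounded sets, the first partial derivative is bounded by a common constant. -/
theorem exists_fderiv_bound [ProperSpace E] {f : E → E → F} {B : E → E → ℝ}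
    (hB : Continuous (Function.uncurry B))
    (hfB : ∀ x y, ‖fderiv ℝ (fun z => f z y) x‖ ≤ B x y) {S T : Set E} (hS : IsCompact S)
    (hT : IsCompact T) :
    ∃ K, 0 ≤ K ∧ ∀ x ∈ S, ∀ y ∈ T, ‖fderiv ℝ (fun z => f z y) x‖ ≤ K := by
  obtain ⟨K, hK⟩ := (hS.prod hT).bddAbove_image hB.continuousOn
  refine ⟨max K 0, le_max_right _ _, fun x hx y hy => ?_⟩
  exact (hfB x y).trans ((hK ⟨(x, y), ⟨hx, hy⟩, rfl⟩).trans (le_max_left _ _))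

theorem continuous_uncurry_of_fderiv_le [ProperSpace E] {f : E → E → F}
    (hfd : ∀ y, Differentiable ℝ fun x => f x y)
    (hfc : ∀ x, Continuous fun y => f x y) {B : E → E → ℝ} (hB : Continuous (Function.uncurry B))
    (hfB : ∀ x y, ‖fderiv ℝ (fun z => f z y) x‖ ≤ B x y) :
    Continuous (Function.uncurry f) := by
  rw [continuous_iff_continuousAt]
  rintro ⟨x, y⟩
  obtain ⟨K, hK0, hK⟩ := exists_fderiv_bound hB hfB (isCompact_closedBall x 1)
    (isCompact_closedBall y 1)
  rw [ContinuousAt, tendsto_iff_norm_sub_tendsto_zero]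
  have hlim : Filter.Tendsto (fun u : E × E => K * ‖u.1 - x‖ + ‖f x u.2 - f x y‖)
      (nhds (x, y)) (nhds 0) := by
    have hc : Continuous fun u : E × E => K * ‖u.1 - x‖ + ‖f x u.2 - f x y‖ := by
      have := (hfc x).comp (continuous_snd (X := E) (Y := E))
      simp only [Function.comp_def] at this
      fun_prop
    simpa using hc.tendsto (x, y)
  refine squeeze_zero' (Filter.Eventually.of_forall fun _ => norm_nonneg _) ?_ hlim
  filter_upwards [prod_mem_nhds (Metric.closedBall_mem_nhds x one_pos)
    (Metric.closedBall_mem_nhds y one_pos)] with u hu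
  have := norm_sub_le_of_fderiv_le hfd (convex_closedBall x 1) hK
    (Metric.mem_closedBall_self zero_le_one) hu.1 hu.2
  calc ‖Function.uncurry f u - Function.uncurry f (x, y)‖
      = ‖(f u.1 u.2 - f x u.2) + (f x u.2 - f x y)‖ := by simp [Function.uncurry]
    _ ≤ _ := (norm_add_le _ _).trans (by gcongr)

theorem aestronglyMeasurable_fderiv_comp [FiniteDimensional ℝ E] [FiniteDimensional ℝ F]
    {f : E → E → F}
    (hf : Continuous (Function.uncurry f)) {x : ℝ → E} (hx : Continuous x) (z : E) :
    AEStronglyMeasurable (fun s => fderiv ℝ (fun z' => f z' (x s)) z) volume := by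
  have : CompleteSpace F := FiniteDimensional.complete ℝ F
  have : ProperSpace E := FiniteDimensional.proper_real E
  borelize E
  have hc : Continuous (Function.uncurry fun (s : ℝ) z' => f z' (x s)) :=
    hf.comp (continuous_snd.prodMk (hx.comp continuous_fst))
  exact ((measurable_fderiv_with_param ℝ hc).comp
    (measurable_id.prodMk measurable_const)).stronglyMeasurable.aestronglyMeasurable

theorem hasFDerivAt_integral_fst [FiniteDimensional ℝ E] [FiniteDimensional ℝ F] {f : E → E → F}
    (hfd : ∀ y, Differentiable ℝ fun x => f x y)
    (hf : Continuous (Function.uncurry f)) {B : E → E → ℝ} (hB : Continuous (Function.uncurry B))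
    (hfB : ∀ x y, ‖fderiv ℝ (fun z => f z y) x‖ ≤ B x y) {x : ℝ → E} (hx : Continuous x)
    (z : E) (a b : ℝ) :
    IntervalIntegrable (fun s => fderiv ℝ (fun z' => f z' (x s)) z) volume a b ∧
      HasFDerivAt (fun z => ∫ s in a..b, f z (x s))
        (∫ s in a..b, fderiv ℝ (fun z' => f z' (x s)) z) z := by
  have : ProperSpace E := FiniteDimensional.proper_real E
  have : CompleteSpace F := FiniteDimensional.complete ℝ F
  obtain ⟨K, hK0, hK⟩ := exists_fderiv_bound hB hfB (isCompact_closedBall z 1)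
    (isCompact_uIcc.image hx : IsCompact (x '' Set.uIcc a b))
  have hfz : ∀ z, Continuous fun s => f z (x s) := fun z =>
    hf.comp (continuous_const.prodMk hx)
  refine intervalIntegral.hasFDerivAt_integral_of_dominated_loc_of_lip (bound := fun _ => K)
    (Metric.closedBall_mem_nhds z one_pos)
    (Filter.Eventually.of_forall fun z' => (hfz z').aestronglyMeasurable)
    ((hfz z).intervalIntegrable _ _) ?_ (Filter.Eventually.of_forall fun s hs => ?_) (by simp)
    (Filter.Eventually.of_forall fun s _ => (hfd (x s) z).hasFDerivAt)
  · exact (aestronglyMeasurable_fderiv_comp hf hx z).restrict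
  · refine (convex_closedBall z 1).lipschitzOnWith_of_nnnorm_fderiv_le (fun y _ => hfd (x s) y)
      fun y hy => ?_
    rw [← NNReal.coe_le_coe]
    simpa [abs_of_nonneg hK0] using hK y hy (x s) ⟨s, Set.uIoc_subset_uIcc hs, rfl⟩

theorem hasDerivAt_integral_diag {g : ℝ → ℝ → F} [CompleteSpace F]
    (hg : Continuous (Function.uncurry g)) (a : ℝ) :
    HasDerivAt (fun τ => ∫ s in a..τ, g τ s) (g a a) a := by
  rw [hasDerivAt_iff_isLittleO, Asymptotics.isLittleO_iff]
  intro ε hε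
  obtain ⟨d, hd, hball⟩ := Metric.continuousAt_iff.1 (hg.continuousAt (x := (a, a))) ε hε
  filter_upwards [Metric.ball_mem_nhds a hd] with τ hτ
  have hgτ : Continuous (g τ) := hg.comp (continuous_const.prodMk continuous_id)
  have : (∫ s in a..τ, g τ s) - (∫ s in a..a, g a s) - (τ - a) • g a a
      = ∫ s in a..τ, (g τ s - g a a) := by
    rw [intervalIntegral.integral_sub (hgτ.intervalIntegrable _ _) (by simp)]
    simp
  rw [this, Real.norm_eq_abs]
  refine intervalIntegral.norm_integral_le_of_norm_le_const fun s hs => ?_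
  rw [← dist_eq_norm]
  refine (hball (x := (τ, s)) ?_).le
  rw [Prod.dist_eq]
  refine max_lt hτ ?_
  have h1 : |s - a| ≤ |τ - a| := by
    have := Set.abs_sub_left_of_mem_uIcc (Set.uIoc_subset_uIcc hs)
    simpa using this
  exact lt_of_le_of_lt h1 hτ

theorem hasDerivAt_integral_comp_diag {X : Type*} [TopologicalSpace X] {f : X → X → F}
    [CompleteSpace F]
    (hf : Continuous (Function.uncurry f)) {x y : ℝ → X} (hx : Continuous x) (hy : Continuous y)
    (t : ℝ) : HasDerivAt (fun τ => ∫ s in t..τ, f (x τ) (y s)) (f (x t) (y t)) t :=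
  hasDerivAt_integral_diag (g := fun τ s => f (x τ) (y s))
    (hf.comp ((hx.comp continuous_fst).prodMk (hy.comp continuous_snd))) t

/-- Leibniz rule for the sliding-window integral of `f (x τ) (x s)`. -/
theorem hasDerivWithinAt_window [FiniteDimensional ℝ E] [FiniteDimensional ℝ F] {f : E → E → F}
    (hfd : ∀ y, Differentiable ℝ fun x => f x y)
    (hf : Continuous (Function.uncurry f)) {B : E → E → ℝ} (hB : Continuous (Function.uncurry B))
    (hfB : ∀ x y, ‖fderiv ℝ (fun z => f z y) x‖ ≤ B x y) {x : ℝ → E} (hx : Continuous x)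
    {S : Set ℝ} {t : ℝ} {u : E} (hxt : HasDerivWithinAt x u S t) (h : ℝ) :
    HasDerivWithinAt (fun τ => ∫ θ in (-h)..0, f (x τ) (x (τ + θ)))
      ((∫ s in t - h..t, fderiv ℝ (fun z => f z (x s)) (x t) u)
        + f (x t) (x t) - f (x t) (x (t - h))) S t := by
  have : CompleteSpace F := FiniteDimensional.complete ℝ F
  have hfz : ∀ z, Continuous fun s => f z (x s) := fun z =>
    hf.comp (continuous_const.prodMk hx)
  have hsplit : (fun τ => ∫ θ in (-h)..0, f (x τ) (x (τ + θ))) = fun τ =>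
      (∫ s in t - h..t, f (x τ) (x s)) + (∫ s in t..τ, f (x τ) (x s))
        - ∫ s in t..τ, f (x τ) (x (s - h)) := by
    ext1 τ
    have hint : ∀ a b, IntervalIntegrable (fun s => f (x τ) (x s)) volume a b := fun a b =>
      (hfz (x τ)).intervalIntegrable a b
    rw [intervalIntegral.integral_comp_add_left (fun s => f (x τ) (x s)) τ,
      intervalIntegral.integral_comp_sub_right (fun s => f (x τ) (x s)) h,
      intervalIntegral.integral_add_adjacent_intervals (hint _ _) (hint _ _), add_zero,
      ← sub_eq_add_neg,
      ← intervalIntegral.integral_add_adjacent_intervals (hint (t - h) (τ - h)) (hint _ τ),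
      add_sub_cancel_left]
  obtain ⟨hi, hd⟩ := hasFDerivAt_integral_fst hfd hf hB hfB hx (x t) (t - h) t
  rw [hsplit, ← ContinuousLinearMap.intervalIntegral_apply hi]
  exact ((hd.comp_hasDerivWithinAt t hxt).add
    (hasDerivAt_integral_comp_diag hf hx hx t).hasDerivWithinAt).sub
    (hasDerivAt_integral_comp_diag hf hx (hx.comp (continuous_id.sub continuous_const)) t
      ).hasDerivWithinAt

theorem hasDerivAt_integral_window {k : ℝ → ℝ} (hk : Continuous k) (h t : ℝ) :
    HasDerivAt (fun τ => ∫ s in τ - h..τ, k s) (k t - k (t - h)) t := by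
  have hint : ∀ a b, IntervalIntegrable k volume a b := fun a b => hk.intervalIntegrable a b
  have hsplit : (fun τ => ∫ s in τ - h..τ, k s) =
      fun τ => (∫ s in (0 : ℝ)..τ, k s) - ∫ s in (0 : ℝ)..τ - h, k s := by
    ext1 τ
    rw [intervalIntegral.integral_interval_sub_left (hint _ _) (hint _ _)]
  have hd : ∀ b, HasDerivAt (fun τ => ∫ s in (0 : ℝ)..τ, k s) (k b) b := fun b =>
    (intervalIntegral.integral_hasDerivAt_right (hint _ _)
      (hk.stronglyMeasurableAtFilter _ _) hk.continuousAt)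
  rw [hsplit]
  exact (hd t).sub ((hd (t - h)).comp_sub_const t h)

theorem hasDerivAt_integral_weighted_window {g : ℝ → ℝ} (hg : Continuous g) (h w1 w2 t : ℝ) :
    HasDerivAt (fun τ => ∫ θ in (-h)..0, (w1 + (h + θ) * w2) * g (τ + θ))
      ((w1 + h * w2) * g t - w1 * g (t - h) - w2 * ∫ s in t - h..t, g s) t := by
  have hk : Continuous fun s => (w1 + (h + s) * w2) * g s := by fun_prop
  have hsplit : (fun τ => ∫ θ in (-h)..0, (w1 + (h + θ) * w2) * g (τ + θ)) = fun τ =>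
      (∫ s in τ - h..τ, (w1 + (h + s) * w2) * g s) - τ * w2 * ∫ s in τ - h..τ, g s := by
    ext1 τ
    rw [← intervalIntegral.integral_const_mul,
      ← intervalIntegral.integral_sub (hk.intervalIntegrable _ _)
        ((by fun_prop : Continuous fun s => τ * w2 * g s).intervalIntegrable _ _)]
    have := intervalIntegral.integral_comp_add_left (a := -h) (b := 0)
      (fun s => (w1 + (h + s) * w2) * g s - τ * w2 * g s) τ
    rw [add_zero, ← sub_eq_add_neg] at this
    rw [← this]
    congr 1
    ext1 θ
    ring
  rw [hsplit]
  have h1 := hasDerivAt_integral_window hk h t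
  have h2 := ((hasDerivAt_id t).mul_const w2).mul (hasDerivAt_integral_window hg h t)
  refine (h1.sub h2).congr_deriv ?_
  simp only [id]
  ring

end ParametricIntegral

section Coordinates

theorem ContinuousLinearMap.apply_eq_sum_single {n : ℕ} {F : Type*} [NormedAddCommGroup F]
    [NormedSpace ℝ F] (T : (Fin n → ℝ) →L[ℝ] F) (v : Fin n → ℝ) :
    T v = ∑ i, v i • T (Pi.single i 1) := by
  conv_lhs => rw [← Finset.univ_sum_single v, map_sum]
  refine Finset.sum_congr rfl fun i _ => ?_
  rw [← map_smul, ← Pi.single_smul, smul_eq_mul, mul_one]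

theorem pd_eq_fderiv {n : ℕ} {f : (Fin n → ℝ) → (Fin n → ℝ) → (Fin n → ℝ)} {x y : Fin n → ℝ}
    (hf : DifferentiableAt ℝ (fun z => f z y) x) (i j : Fin n) :
    pd n f i j x y = fderiv ℝ (fun z => f z y) x (Pi.single j 1) i := by
  have h1 : HasDerivAt (Function.update x j) (Pi.single j 1) (x j) := hasDerivAt_update x j (x j)
  have h2 : HasFDerivAt (fun z => f z y) (fderiv ℝ (fun z => f z y) x)
      (Function.update x j (x j)) := by
    rw [Function.update_eq_self]
    exact hf.hasFDerivAt
  exact (hasDerivAt_pi.1 (h2.comp_hasDerivAt (x j) h1) i).deriv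

theorem fderiv_apply_eq_sum_pd {n : ℕ} {f : (Fin n → ℝ) → (Fin n → ℝ) → (Fin n → ℝ)}
    {x y : Fin n → ℝ} (hf : DifferentiableAt ℝ (fun z => f z y) x) (v : Fin n → ℝ) (i : Fin n) :
    fderiv ℝ (fun z => f z y) x v i = ∑ j, v j * pd n f i j x y := by
  rw [ContinuousLinearMap.apply_eq_sum_single, Finset.sum_apply]
  simp [pd_eq_fderiv hf]

theorem norm_fderiv_le_sum_pd {n : ℕ} {f : (Fin n → ℝ) → (Fin n → ℝ) → (Fin n → ℝ)}
    {x y : Fin n → ℝ} (hf : DifferentiableAt ℝ (fun z => f z y) x) :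
    ‖fderiv ℝ (fun z => f z y) x‖ ≤ ∑ i, ∑ j, |pd n f i j x y| := by
  have h0 : ∀ i, 0 ≤ ∑ j, |pd n f i j x y| := fun i => Finset.sum_nonneg fun _ _ => abs_nonneg _
  refine ContinuousLinearMap.opNorm_le_bound _ (Finset.sum_nonneg fun i _ => h0 i) fun v => ?_
  refine (pi_norm_le_iff_of_nonneg
    (mul_nonneg (Finset.sum_nonneg fun i _ => h0 i) (norm_nonneg v))).2 fun i => ?_
  rw [fderiv_apply_eq_sum_pd hf, Real.norm_eq_abs]
  calc |∑ j, v j * pd n f i j x y| ≤ ∑ j, |v j * pd n f i j x y| := Finset.abs_sum_le_sum_abs _ _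
    _ ≤ ∑ j, |pd n f i j x y| * ‖v‖ := by
        refine Finset.sum_le_sum fun j _ => ?_
        rw [abs_mul, mul_comm]
        gcongr
        exact norm_le_pi_norm v j
    _ ≤ _ := by
        rw [← Finset.sum_mul]
        exact mul_le_mul_of_nonneg_right (Finset.single_le_sum
          (f := fun i => ∑ j, |pd n f i j x y|) (fun i _ => h0 i) (Finset.mem_univ i))
          (norm_nonneg v)

theorem abs_apply_le_sum {n : ℕ} (T : (Fin n → ℝ) →L[ℝ] ℝ) {B v' : Fin n → ℝ} {v : Fin n → ℝ}
    (hT : ∀ i, |T (Pi.single i 1)| ≤ B i) (hv : ∀ i, |v i| ≤ v' i) :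
    |T v| ≤ ∑ i, v' i * B i := by
  rw [T.apply_eq_sum_single]
  refine (Finset.abs_sum_le_sum_abs _ _).trans (Finset.sum_le_sum fun i _ => ?_)
  rw [smul_eq_mul, abs_mul]
  exact mul_le_mul (hv i) (hT i) (abs_nonneg _) ((abs_nonneg _).trans (hv i))

theorem abs_fderiv_fderiv_apply_le_sum {n : ℕ} {V : (Fin n → ℝ) → ℝ} (hV : ContDiff ℝ 2 V)
    {x u v : Fin n → ℝ} {u' v' : Fin n → ℝ} {P : Fin n → Fin n → ℝ}
    (hP : ∀ i j, |fderiv ℝ (fun z => fderiv ℝ V z (Pi.single i 1)) x (Pi.single j 1)| ≤ P i j)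
    (hu : ∀ j, |u j| ≤ u' j) (hv : ∀ i, |v i| ≤ v' i) :
    |fderiv ℝ (fderiv ℝ V) x u v| ≤ ∑ i, ∑ j, v' i * (u' j * P i j) := by
  have hd : DifferentiableAt ℝ (fderiv ℝ V) x :=
    (hV.fderiv_right (m := 1) (by norm_num)).differentiable (by norm_num) x
  simp only [← Finset.mul_sum]
  refine abs_apply_le_sum _ (fun i => ?_) hv
  have he : fderiv ℝ (fderiv ℝ V) x u (Pi.single i 1)
      = fderiv ℝ (fun z => fderiv ℝ V z (Pi.single i 1)) x u := by
    rw [fderiv_clm_apply hd (differentiableAt_const _)]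
    simp
  rw [he]
  exact abs_apply_le_sum _ (hP i) hu

end Coordinates

section Monomials

theorem rpow_mul_add_mul_add_le {x y z δ k a b q e : ℝ} (hx : 0 ≤ x) (hy : 0 ≤ y) (hz : 0 ≤ z)
    (hxδ : x ≤ δ) (hyδ : y ≤ δ) (hzδ : z ≤ δ) (hk : 0 ≤ k) (ha : 0 ≤ a) (hb : 0 ≤ b)
    (hq : 0 ≤ q) (he : 0 ≤ e) (h : k + a + b = q + e) :
    x ^ k * (x ^ a + y ^ a) * (x ^ b + z ^ b) ≤ δ ^ e * (4 * x ^ q + 2 * y ^ q + 2 * z ^ q) := by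
  have h1 := rpow_le_rpow_mul_rpow hx hxδ hq he
  rw [← h, Real.rpow_add_of_nonneg hx (add_nonneg hk ha) hb, Real.rpow_add_of_nonneg hx hk ha] at h1
  have h2 := rpow_mul_rpow_le hx hz hxδ hzδ (add_nonneg hk ha) hb hq he h
  rw [Real.rpow_add_of_nonneg hx hk ha] at h2
  have h3 := rpow_mul_rpow_le hx hy hxδ hyδ (add_nonneg hk hb) ha hq he (by linarith)
  rw [Real.rpow_add_of_nonneg hx hk hb] at h3
  have h4 := rpow_mul_rpow_mul_rpow_le hx hy hz hxδ hyδ hzδ hk ha hb hq he h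
  linarith

theorem rpow_mul_add_le {x y δ k b q e : ℝ} (hx : 0 ≤ x) (hy : 0 ≤ y)
    (hxδ : x ≤ δ) (hyδ : y ≤ δ) (hk : 0 ≤ k) (hb : 0 ≤ b)
    (hq : 0 ≤ q) (he : 0 ≤ e) (h : k + b = q + e) :
    x ^ k * (x ^ b + y ^ b) ≤ δ ^ e * (2 * x ^ q + y ^ q) := by
  have h1 := rpow_le_rpow_mul_rpow hx hxδ hq he
  rw [← h, Real.rpow_add_of_nonneg hx hk hb] at h1
  have h2 := rpow_mul_rpow_le hx hy hxδ hyδ hk hb hq he h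
  linarith

theorem integral_le_add_mul_integral {F G : ℝ → ℝ} {a b A B : ℝ} (hab : a ≤ b)
    (hF : IntervalIntegrable F MeasureTheory.volume a b)
    (hG : IntervalIntegrable G MeasureTheory.volume a b)
    (h : ∀ s ∈ Set.Icc a b, F s ≤ A + B * G s) :
    ∫ s in a..b, F s ≤ (b - a) * A + B * ∫ s in a..b, G s := by
  refine (intervalIntegral.integral_mono_on hab hF
    (intervalIntegrable_const.add (hG.const_mul B)) h).trans_eq ?_
  rw [intervalIntegral.integral_add intervalIntegrable_const (hG.const_mul B)]
  simp

theorem rpow_lt_of_lt_rpow_one_div {δ K μ : ℝ} (hδ : 0 ≤ δ) (hμ : 0 < μ) (hK : 0 ≤ K)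
    (h : δ < K ^ (1 / μ)) : δ ^ μ < K := by
  have := Real.rpow_lt_rpow hδ h hμ
  rwa [← Real.rpow_mul hK, one_div_mul_cancel hμ.ne', Real.rpow_one] at this

end Monomials

section Functional

variable {n : ℕ} {r : Fin n → ℝ} {p h μ γ w1 w2 : ℝ}
  {f : (Fin n → ℝ) → (Fin n → ℝ) → (Fin n → ℝ)} {V : (Fin n → ℝ) → ℝ}

theorem abs_fderiv_apply_le_sum {m β : Fin n → ℝ} {x : Fin n → ℝ}
    (hfm : ∀ x y : Fin n → ℝ, ∀ i,
      |f x y i| ≤ m i * (hnorm n r p x ^ (μ + r i) + hnorm n r p y ^ (μ + r i)))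
    (hVd : ∀ i, |fderiv ℝ V x (Pi.single i 1)| ≤ β i * hnorm n r p x ^ (γ - r i))
    (y : Fin n → ℝ) :
    |fderiv ℝ V x (f x y)| ≤ ∑ i, β i * m i * (hnorm n r p x ^ (γ - r i) *
      (hnorm n r p x ^ (μ + r i) + hnorm n r p y ^ (μ + r i))) := by
  refine (abs_apply_le_sum _ hVd (hfm x y)).trans_eq (Finset.sum_congr rfl fun i _ => ?_)
  ring

theorem vfun_eq_add_integral (hr : ∀ i, 0 < r i) (hp : 0 < p) (hq : 0 ≤ γ + μ)
    (hf : ∀ x, Continuous fun y => f x y) {φ : ℝ → Fin n → ℝ} (hφ : Continuous φ) :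
    IntervalIntegrable (fun θ => fderiv ℝ V (φ 0) (f (φ 0) (φ θ))
        + (w1 + (h + θ) * w2) * hnorm n r p (φ θ) ^ (γ + μ)) MeasureTheory.volume (-h) 0 ∧
      vfun n r p h μ γ w1 w2 f V φ = V (φ 0) + ∫ θ in (-h)..0,
        (fderiv ℝ V (φ 0) (f (φ 0) (φ θ)) + (w1 + (h + θ) * w2) * hnorm n r p (φ θ) ^ (γ + μ)) := by
  have hfφ : Continuous fun θ => f (φ 0) (φ θ) := (hf (φ 0)).comp hφ
  have h1 : Continuous fun θ => fderiv ℝ V (φ 0) (f (φ 0) (φ θ)) :=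
    (fderiv ℝ V (φ 0)).continuous.comp hfφ
  have hN : Continuous fun θ => hnorm n r p (φ θ) ^ (γ + μ) :=
    ((continuous_hnorm hr hp).comp hφ).rpow_const fun _ => Or.inr hq
  have h2 : Continuous fun θ => (w1 + (h + θ) * w2) * hnorm n r p (φ θ) ^ (γ + μ) := by fun_prop
  refine ⟨(h1.add h2).intervalIntegrable _ _, ?_⟩
  rw [vfun, intervalIntegral.integral_add (h1.intervalIntegrable _ _) (h2.intervalIntegrable _ _),
    ContinuousLinearMap.intervalIntegral_comp_comm _ (hfφ.intervalIntegrable _ _), add_assoc]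

theorem vfun_le (hr : ∀ i, 0 < r i) (hp : 0 < p) (hh : 0 < h) (hμ : 0 < μ) (hγ0 : 0 < γ)
    (hγ : ∀ i, 2 * r i ≤ γ) (hf : ∀ x, Continuous fun y => f x y)
    {m β : Fin n → ℝ} (hm : ∀ i, 0 < m i) (hβ : ∀ i, 0 < β i)
    (hfm : ∀ x y : Fin n → ℝ, ∀ i,
      |f x y i| ≤ m i * (hnorm n r p x ^ (μ + r i) + hnorm n r p y ^ (μ + r i)))
    (hVd : ∀ x : Fin n → ℝ, ∀ i,
      |fderiv ℝ V x (Pi.single i 1)| ≤ β i * hnorm n r p x ^ (γ - r i))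
    {α1 : ℝ} (hVub : ∀ x : Fin n → ℝ, V x ≤ α1 * hnorm n r p x ^ γ)
    (hw1 : 0 < w1) (hw2 : 0 < w2) {δ : ℝ} {φ : ℝ → Fin n → ℝ} (hφ : Continuous φ)
    (hφδ : ∀ θ ∈ Set.Icc (-h) (0:ℝ), hnorm n r p (φ θ) ≤ δ) :
    vfun n r p h μ γ w1 w2 f V φ ≤
      (α1 + 2 * h * (∑ i, β i * m i) * δ ^ μ) * hnorm n r p (φ 0) ^ γ
      + (w1 + h * w2 + ∑ i, β i * m i) * δ ^ μ * ∫ θ in (-h)..0, hnorm n r p (φ θ) ^ γ := by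
  obtain ⟨hint, heq⟩ := vfun_eq_add_integral (h := h) (w1 := w1) (w2 := w2) (V := V) hr hp
    (by linarith : 0 ≤ γ + μ) hf hφ
  have h0 := hφδ 0 ⟨by linarith, le_rfl⟩
  have hX := hnorm_nonneg (r := r) (p := p) (φ 0)
  have hN : Continuous fun θ => hnorm n r p (φ θ) ^ γ :=
    ((continuous_hnorm hr hp).comp hφ).rpow_const fun _ => Or.inr hγ0.le
  set S := ∑ i, β i * m i with hS
  have hS0 : 0 ≤ S := Finset.sum_nonneg fun i _ => (mul_pos (hβ i) (hm i)).le
  have hle := integral_le_add_mul_integral (A := 2 * S * δ ^ μ * hnorm n r p (φ 0) ^ γ)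
    (B := (w1 + h * w2 + S) * δ ^ μ) (by linarith : -h ≤ 0) hint (hN.intervalIntegrable _ _)
    fun θ hθ => by
      have hY := hnorm_nonneg (r := r) (p := p) (φ θ)
      have hYδ := hφδ θ hθ
      have h1 : fderiv ℝ V (φ 0) (f (φ 0) (φ θ)) ≤
          S * (δ ^ μ * (2 * hnorm n r p (φ 0) ^ γ + hnorm n r p (φ θ) ^ γ)) := by
        refine (le_abs_self _).trans ((abs_fderiv_apply_le_sum hfm (hVd _) _).trans ?_)
        rw [hS, Finset.sum_mul]
        refine Finset.sum_le_sum fun i _ => mul_le_mul_of_nonneg_left ?_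
          (mul_pos (hβ i) (hm i)).le
        have := hr i
        have := hγ i
        exact rpow_mul_add_le hX hY h0 hYδ (by linarith) (by linarith) hγ0.le hμ.le (by ring)
      have h2 : (w1 + (h + θ) * w2) * hnorm n r p (φ θ) ^ (γ + μ) ≤
          (w1 + h * w2) * (δ ^ μ * hnorm n r p (φ θ) ^ γ) := by
        refine mul_le_mul ?_ (rpow_le_rpow_mul_rpow hY hYδ hγ0.le hμ.le)
          (Real.rpow_nonneg hY _) (by positivity)
        nlinarith [hθ.2]
      linarith
  rw [heq]
  have := hVub (φ 0)
  linarith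

theorem vfun_nonneg (hr : ∀ i, 0 < r i) (hp : 0 < p) (hh : 0 < h) (hμ : 0 < μ) (hγ0 : 0 < γ)
    (hγ : ∀ i, 2 * r i ≤ γ) (hf : ∀ x, Continuous fun y => f x y)
    {m β : Fin n → ℝ} (hm : ∀ i, 0 < m i) (hβ : ∀ i, 0 < β i)
    (hfm : ∀ x y : Fin n → ℝ, ∀ i,
      |f x y i| ≤ m i * (hnorm n r p x ^ (μ + r i) + hnorm n r p y ^ (μ + r i)))
    (hVd : ∀ x : Fin n → ℝ, ∀ i,
      |fderiv ℝ V x (Pi.single i 1)| ≤ β i * hnorm n r p x ^ (γ - r i))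
    {α0 : ℝ} (hVlb : ∀ x : Fin n → ℝ, α0 * hnorm n r p x ^ γ ≤ V x)
    (hw2 : 0 < w2) {χ δ : ℝ} (hχ : 0 < χ)
    (hχw : ∑ i, β i * m i * χ ^ (2 * (γ - r i)) ≤ w1)
    (hδ : h * (∑ i, β i * m i * (1 + χ ^ (-2 * (μ + r i)))) * δ ^ μ ≤ α0)
    {φ : ℝ → Fin n → ℝ} (hφ : Continuous φ) (hφδ : hnorm n r p (φ 0) ≤ δ) :
    0 ≤ vfun n r p h μ γ w1 w2 f V φ := by
  obtain ⟨hint, heq⟩ := vfun_eq_add_integral (h := h) (w1 := w1) (w2 := w2) (V := V) hr hp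
    (by linarith : 0 ≤ γ + μ) hf hφ
  have hX := hnorm_nonneg (r := r) (p := p) (φ 0)
  set C := ∑ i, β i * m i * (1 + χ ^ (-2 * (μ + r i))) with hC
  have hC0 : 0 ≤ C := Finset.sum_nonneg fun i _ =>
    mul_nonneg (mul_pos (hβ i) (hm i)).le (by positivity)
  have hle := integral_le_add_mul_integral (A := C * δ ^ μ * hnorm n r p (φ 0) ^ γ)
    (B := 0) (by linarith : -h ≤ 0) hint.neg (intervalIntegrable_const (c := (0 : ℝ)))
    fun θ hθ => by
      have hY := hnorm_nonneg (r := r) (p := p) (φ θ)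
      have hYq := Real.rpow_nonneg hY (γ + μ)
      have h1 : -fderiv ℝ V (φ 0) (f (φ 0) (φ θ)) ≤ C * hnorm n r p (φ 0) ^ (γ + μ) +
          (∑ i, β i * m i * χ ^ (2 * (γ - r i))) * hnorm n r p (φ θ) ^ (γ + μ) := by
        refine (neg_le_abs _).trans ((abs_fderiv_apply_le_sum hfm (hVd _) _).trans ?_)
        rw [hC, Finset.sum_mul, Finset.sum_mul, ← Finset.sum_add_distrib]
        refine Finset.sum_le_sum fun i _ => ?_
        have hri := hr i
        have hγi := hγ i
        have e1 := rpow_mul_rpow_le_weighted hX hY (a := γ - r i) (b := μ + r i) (by linarith)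
          (by linarith) hχ
        have e2 : hnorm n r p (φ 0) ^ (γ - r i) * hnorm n r p (φ 0) ^ (μ + r i)
            = hnorm n r p (φ 0) ^ (γ + μ) := by
          rw [← Real.rpow_add_of_nonneg hX (by linarith) (by linarith)]
          ring_nf
        rw [show γ - r i + (μ + r i) = γ + μ by ring] at e1
        have e3 := mul_le_mul_of_nonneg_left (add_le_add e2.le e1) (mul_pos (hβ i) (hm i)).le
        linarith
      have h2 : (∑ i, β i * m i * χ ^ (2 * (γ - r i))) * hnorm n r p (φ θ) ^ (γ + μ) ≤
          (w1 + (h + θ) * w2) * hnorm n r p (φ θ) ^ (γ + μ) := by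
        gcongr
        nlinarith [hθ.1]
      have h3 := mul_le_mul_of_nonneg_left (rpow_le_rpow_mul_rpow hX hφδ hγ0.le hμ.le) hC0
      simp only [Pi.neg_apply, zero_mul, add_zero]
      linarith
  have hneg := intervalIntegral.integral_neg (μ := MeasureTheory.volume) (a := -h) (b := 0)
    (f := fun θ => fderiv ℝ V (φ 0) (f (φ 0) (φ θ))
        + (w1 + (h + θ) * w2) * hnorm n r p (φ θ) ^ (γ + μ))
  simp only [Pi.neg_apply] at hle
  rw [hneg] at hle
  rw [heq]
  have h1 := hVlb (φ 0)
  have h2 := mul_le_mul_of_nonneg_right hδ (Real.rpow_nonneg hX γ)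
  linarith

/-- The two second-order terms in the derivative of the functional are bounded by
`L * δ ^ μ` times homogeneous terms of degree `γ + μ`. -/
theorem second_order_terms_le (hr : ∀ i, 0 < r i) (hμ : 0 < μ) (hγ0 : 0 < γ)
    (hγ : ∀ i, 2 * r i ≤ γ) (hfd : ∀ y, Differentiable ℝ fun x => f x y)
    {m β : Fin n → ℝ} (hm : ∀ i, 0 < m i) (hβ : ∀ i, 0 < β i)
    (hfm : ∀ x y : Fin n → ℝ, ∀ i,
      |f x y i| ≤ m i * (hnorm n r p x ^ (μ + r i) + hnorm n r p y ^ (μ + r i)))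
    {η : Fin n → Fin n → ℝ} (hη : ∀ i j, 0 < η i j)
    (hfd1 : ∀ i j, 0 ≤ μ + r i - r j → ∀ x y : Fin n → ℝ,
      |pd n f i j x y| ≤ η i j * (hnorm n r p x ^ (μ + r i - r j) + hnorm n r p y ^ (μ + r i - r j)))
    (hfd2 : ∀ i j, μ + r i - r j < 0 → ∀ x y : Fin n → ℝ, |pd n f i j x y| ≤ η i j)
    (hV : ContDiff ℝ 2 V)
    (hVd : ∀ x : Fin n → ℝ, ∀ i,
      |fderiv ℝ V x (Pi.single i 1)| ≤ β i * hnorm n r p x ^ (γ - r i))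
    {ψ : Fin n → Fin n → ℝ} (hψ : ∀ i j, 0 < ψ i j)
    (hVdd : ∀ x : Fin n → ℝ, ∀ i j,
      |fderiv ℝ (fun z => fderiv ℝ V z (Pi.single i 1)) x (Pi.single j 1)|
        ≤ ψ i j * hnorm n r p x ^ (γ - r i - r j))
    {δ : ℝ} (hδ0 : 0 < δ) {x y z : Fin n → ℝ} (hx : hnorm n r p x ≤ δ) (hy : hnorm n r p y ≤ δ)
    (hz : hnorm n r p z ≤ δ) :
    fderiv ℝ (fderiv ℝ V) x (f x z) (f x y)
        + fderiv ℝ V x (fderiv ℝ (fun x' => f x' y) x (f x z)) ≤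
      (∑ i, ∑ j, m j * (β i * η i j *
        (if 0 ≤ μ + r i - r j then 1 else δ ^ (r j - r i - μ)) + m i * ψ i j)) *
      (δ ^ μ * (4 * hnorm n r p x ^ (γ + μ) + 2 * hnorm n r p y ^ (γ + μ)
        + 2 * hnorm n r p z ^ (γ + μ))) := by
  have hX := hnorm_nonneg (r := r) (p := p) x
  have hY := hnorm_nonneg (r := r) (p := p) y
  have hZ := hnorm_nonneg (r := r) (p := p) z
  have hXq := Real.rpow_nonneg hX (γ + μ)
  have hYq := Real.rpow_nonneg hY (γ + μ)
  have hZq := Real.rpow_nonneg hZ (γ + μ)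
  have hq : 0 ≤ γ + μ := by linarith
  set X := hnorm n r p x
  set Y := hnorm n r p y
  set Z := hnorm n r p z
  set Q := δ ^ μ * (4 * X ^ (γ + μ) + 2 * Y ^ (γ + μ) + 2 * Z ^ (γ + μ)) with hQ
  have hT1 : fderiv ℝ (fderiv ℝ V) x (f x z) (f x y) ≤ ∑ i, ∑ j, m j * (m i * ψ i j) * Q := by
    refine (le_abs_self _).trans ((abs_fderiv_fderiv_apply_le_sum hV (hVdd x) (hfm x z)
      (hfm x y)).trans ?_)
    refine Finset.sum_le_sum fun i _ => Finset.sum_le_sum fun j _ => ?_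
    have hri := hr i
    have hrj := hr j
    have hγi := hγ i
    have hγj := hγ j
    have := rpow_mul_add_mul_add_le hX hY hZ hx hy hz (k := γ - r i - r j) (a := μ + r i)
      (b := μ + r j) (by linarith) (by linarith) (by linarith) hq hμ.le (by ring)
    have h0 : 0 ≤ m j * (m i * ψ i j) :=
      (mul_pos (hm j) (mul_pos (hm i) (hψ i j))).le
    exact (mul_le_mul_of_nonneg_left this h0).trans' (le_of_eq (by ring))
  have hT2 : fderiv ℝ V x (fderiv ℝ (fun x' => f x' y) x (f x z)) ≤ ∑ i, ∑ j, m j * (β i * η i j *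
        (if 0 ≤ μ + r i - r j then 1 else δ ^ (r j - r i - μ))) * Q := by
    have hv : ∀ i, |fderiv ℝ (fun x' => f x' y) x (f x z) i| ≤
        ∑ j, m j * (X ^ (μ + r j) + Z ^ (μ + r j)) * |pd n f i j x y| := by
      intro i
      rw [fderiv_apply_eq_sum_pd (hfd y x)]
      refine (Finset.abs_sum_le_sum_abs _ _).trans (Finset.sum_le_sum fun j _ => ?_)
      rw [abs_mul]
      exact mul_le_mul_of_nonneg_right (hfm x z j) (abs_nonneg _)
    refine (le_abs_self _).trans ((abs_apply_le_sum _ (hVd x) hv).trans ?_)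
    refine Finset.sum_le_sum fun i _ => ?_
    rw [Finset.sum_mul]
    refine Finset.sum_le_sum fun j _ => ?_
    have hri := hr i
    have hrj := hr j
    have hγi := hγ i
    have hγj := hγ j
    have hmj := hm j
    have hβi := hβ i
    have hηij := hη i j
    change m j * (X ^ (μ + r j) + Z ^ (μ + r j)) * |pd n f i j x y| * (β i * X ^ (γ - r i)) ≤ _
    have h0 : 0 ≤ m j * (β i * η i j) := by positivity
    split_ifs with hs
    · have := rpow_mul_add_mul_add_le hX hY hZ hx hy hz (k := γ - r i) (a := μ + r i - r j)
        (b := μ + r j) (by linarith) hs (by linarith) hq hμ.le (by ring)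
      calc _ ≤ m j * (X ^ (μ + r j) + Z ^ (μ + r j)) *
            (η i j * (X ^ (μ + r i - r j) + Y ^ (μ + r i - r j))) * (β i * X ^ (γ - r i)) := by
            gcongr
            exact hfd1 i j hs x y
        _ = m j * (β i * η i j) * (X ^ (γ - r i) * (X ^ (μ + r i - r j) + Y ^ (μ + r i - r j)) *
            (X ^ (μ + r j) + Z ^ (μ + r j))) := by ring
        _ ≤ m j * (β i * η i j) * Q := mul_le_mul_of_nonneg_left this h0
        _ = _ := by ring
    · have hs' := not_le.1 hs
      have := rpow_mul_add_le hX hZ hx hz (k := γ - r i) (b := μ + r j)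
        (e := (r j - r i - μ) + μ) (by linarith) (by linarith) hq (by linarith) (by ring)
      rw [Real.rpow_add hδ0] at this
      calc _ ≤ m j * (X ^ (μ + r j) + Z ^ (μ + r j)) * η i j * (β i * X ^ (γ - r i)) := by
            gcongr
            exact hfd2 i j hs' x y
        _ = m j * (β i * η i j) * (X ^ (γ - r i) * (X ^ (μ + r j) + Z ^ (μ + r j))) := by ring
        _ ≤ m j * (β i * η i j) * (δ ^ (r j - r i - μ) * Q) := by
            refine mul_le_mul_of_nonneg_left (this.trans ?_) h0
            rw [hQ, mul_assoc]
            gcongr <;> linarith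
        _ = _ := by ring
  refine (add_le_add hT1 hT2).trans_eq ?_
  simp only [Finset.sum_mul, ← Finset.sum_add_distrib]
  refine Finset.sum_congr rfl fun i _ => Finset.sum_congr rfl fun j _ => ?_
  ring

theorem hasDerivWithinAt_vfun (hr : ∀ i, 0 < r i) (hp : 0 < p) (hq : 0 ≤ γ + μ)
    (hfd : ∀ y, Differentiable ℝ fun x => f x y)
    (hf : Continuous (Function.uncurry f)) {B : (Fin n → ℝ) → (Fin n → ℝ) → ℝ}
    (hB : Continuous (Function.uncurry B)) (hfB : ∀ x y, ‖fderiv ℝ (fun z => f z y) x‖ ≤ B x y)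
    (hV : ContDiff ℝ 2 V) {x : ℝ → Fin n → ℝ} (hx : Continuous x) {T : Set ℝ} {t : ℝ}
    (hxt : HasDerivWithinAt x (f (x t) (x (t - h))) T t) :
    IntervalIntegrable (fun s => fderiv ℝ (fderiv ℝ V) (x t) (f (x t) (x (t - h))) (f (x t) (x s))
        + fderiv ℝ V (x t) (fderiv ℝ (fun z => f z (x s)) (x t) (f (x t) (x (t - h)))))
        MeasureTheory.volume (t - h) t ∧
    HasDerivWithinAt (fun τ => vfun n r p h μ γ w1 w2 f V (fun θ => x (τ + θ)))
      (fderiv ℝ V (x t) (f (x t) (x t))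
        + (∫ s in t - h..t, (fderiv ℝ (fderiv ℝ V) (x t) (f (x t) (x (t - h))) (f (x t) (x s))
          + fderiv ℝ V (x t) (fderiv ℝ (fun z => f z (x s)) (x t) (f (x t) (x (t - h))))))
        + ((w1 + h * w2) * hnorm n r p (x t) ^ (γ + μ) - w1 * hnorm n r p (x (t - h)) ^ (γ + μ)
          - w2 * ∫ s in t - h..t, hnorm n r p (x s) ^ (γ + μ))) T t := by
  set u := f (x t) (x (t - h)) with hu
  have hfx : Continuous fun s => f (x t) (x s) := hf.comp (continuous_const.prodMk hx)
  have hN : Continuous fun s => hnorm n r p (x s) ^ (γ + μ) :=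
    ((continuous_hnorm hr hp).comp hx).rpow_const fun _ => Or.inr hq
  have hi := (hasFDerivAt_integral_fst hfd hf hB hfB hx (x t) (t - h) t).1
  have hiu : IntervalIntegrable (fun s => fderiv ℝ (fun z => f z (x s)) (x t) u)
      MeasureTheory.volume (t - h) t :=
    ⟨(ContinuousLinearMap.apply ℝ (Fin n → ℝ) u).integrable_comp hi.1,
      (ContinuousLinearMap.apply ℝ (Fin n → ℝ) u).integrable_comp hi.2⟩
  have hi1 : IntervalIntegrable (fun s => fderiv ℝ (fderiv ℝ V) (x t) u (f (x t) (x s)))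
      MeasureTheory.volume (t - h) t :=
    ((fderiv ℝ (fderiv ℝ V) (x t) u).continuous.comp hfx).intervalIntegrable _ _
  have hi2 : IntervalIntegrable
      (fun s => fderiv ℝ V (x t) (fderiv ℝ (fun z => f z (x s)) (x t) u))
      MeasureTheory.volume (t - h) t :=
    ⟨(fderiv ℝ V (x t)).integrable_comp hiu.1, (fderiv ℝ V (x t)).integrable_comp hiu.2⟩
  refine ⟨hi1.add hi2, ?_⟩
  have hdV : HasFDerivAt V (fderiv ℝ V (x t)) (x t) :=
    (hV.differentiable (by norm_num) _).hasFDerivAt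
  have hddV : HasFDerivAt (fderiv ℝ V) (fderiv ℝ (fderiv ℝ V) (x t)) (x t) :=
    ((hV.fderiv_right (m := 1) (by norm_num)).differentiable (by norm_num) _).hasFDerivAt
  have hW := hasDerivWithinAt_window hfd hf hB hfB hx hxt h
  have hG := (hasDerivAt_integral_weighted_window hN h w1 w2 t).hasDerivWithinAt (s := T)
  have hmain := ((hdV.comp_hasDerivWithinAt t hxt).add
    ((hddV.comp_hasDerivWithinAt t hxt).clm_apply hW)).add hG
  have hwin : ∫ θ in (-h)..0, f (x t) (x (t + θ)) = ∫ s in t - h..t, f (x t) (x s) := by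
    rw [intervalIntegral.integral_comp_add_left (fun s => f (x t) (x s)) t, add_zero,
      ← sub_eq_add_neg]
  rw [intervalIntegral.integral_add hi1 hi2,
    ContinuousLinearMap.intervalIntegral_comp_comm _ (hfx.intervalIntegrable _ _),
    ContinuousLinearMap.intervalIntegral_comp_comm _ hiu]
  have hfun : (fun τ => vfun n r p h μ γ w1 w2 f V (fun θ => x (τ + θ))) = fun τ =>
      V (x τ) + fderiv ℝ V (x τ) (∫ θ in (-h)..0, f (x τ) (x (τ + θ)))
        + ∫ θ in (-h)..0, (w1 + (h + θ) * w2) * hnorm n r p (x (τ + θ)) ^ (γ + μ) := by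
    simp only [vfun, add_zero]
  rw [hfun]
  refine hmain.congr_deriv ?_
  rw [hwin]
  simp only [Function.comp_apply, map_add, map_sub]
  ring

theorem exists_continuous_fderiv_bound (hr : ∀ i, 0 < r i) (hp : 0 < p)
    (hfd : ∀ y, Differentiable ℝ fun x => f x y) {η : Fin n → Fin n → ℝ}
    (hfd1 : ∀ i j, 0 ≤ μ + r i - r j → ∀ x y : Fin n → ℝ,
      |pd n f i j x y| ≤ η i j * (hnorm n r p x ^ (μ + r i - r j) + hnorm n r p y ^ (μ + r i - r j)))
    (hfd2 : ∀ i j, μ + r i - r j < 0 → ∀ x y : Fin n → ℝ, |pd n f i j x y| ≤ η i j) :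
    ∃ B : (Fin n → ℝ) → (Fin n → ℝ) → ℝ, Continuous (Function.uncurry B) ∧
      ∀ x y : Fin n → ℝ, ‖fderiv ℝ (fun z => f z y) x‖ ≤ B x y := by
  refine ⟨fun x y => ∑ i, ∑ j, if 0 ≤ μ + r i - r j then
    η i j * (hnorm n r p x ^ (μ + r i - r j) + hnorm n r p y ^ (μ + r i - r j)) else η i j,
    ?_, fun x y => (norm_fderiv_le_sum_pd (hfd y x)).trans
      (Finset.sum_le_sum fun i _ => Finset.sum_le_sum fun j _ => ?_)⟩
  · refine continuous_finsetSum _ fun i _ => continuous_finsetSum _ fun j _ => ?_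
    split_ifs with hs
    · have hc := (continuous_hnorm hr hp).rpow_const (p := μ + r i - r j) fun _ => Or.inr hs
      exact continuous_const.mul ((hc.comp continuous_fst).add (hc.comp continuous_snd))
    · exact continuous_const
  · split_ifs with hs
    · exact hfd1 i j hs x y
    · exact hfd2 i j (not_le.1 hs) x y

theorem vfun_congr (hh : 0 < h) {φ φ' : ℝ → Fin n → ℝ} (hφ : Set.EqOn φ φ' (Set.Icc (-h) 0)) :
    vfun n r p h μ γ w1 w2 f V φ = vfun n r p h μ γ w1 w2 f V φ' := by
  have h0 : φ 0 = φ' 0 := hφ ⟨by linarith, le_rfl⟩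
  have hle : -h ≤ 0 := by linarith
  have hon : ∀ θ ∈ Set.uIcc (-h) 0, φ θ = φ' θ := fun θ hθ => hφ (Set.uIcc_of_le hle ▸ hθ)
  have h1 : ∫ θ in (-h)..0, f (φ' 0) (φ θ) = ∫ θ in (-h)..0, f (φ' 0) (φ' θ) :=
    intervalIntegral.integral_congr fun θ hθ => by simp only [hon θ hθ]
  have h2 : ∫ θ in (-h)..0, (w1 + (h + θ) * w2) * hnorm n r p (φ θ) ^ (γ + μ) =
      ∫ θ in (-h)..0, (w1 + (h + θ) * w2) * hnorm n r p (φ' θ) ^ (γ + μ) :=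
    intervalIntegral.integral_congr fun θ hθ => by simp only [hon θ hθ]
  rw [vfun, vfun, h0, h1, h2]

end Functional

theorem stmt12
    (n : ℕ) (hn : 1 ≤ n) (r : Fin n → ℝ) (hr : ∀ i, 0 < r i) (p : ℝ) (hp : 1 ≤ p)
    (h μ : ℝ) (hh : 0 < h) (hμ : 0 < μ)
    (f : (Fin n → ℝ) → (Fin n → ℝ) → (Fin n → ℝ))
    (hf_cd : ∀ y : Fin n → ℝ, ContDiff ℝ 1 fun x => f x y)
    (hf_lip : ∀ x : Fin n → ℝ, LocallyLipschitz fun y => f x y)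
    (hf_hom : ∀ ε : ℝ, 0 < ε → ∀ x y : Fin n → ℝ, ∀ i,
      f (fun k => ε ^ r k * x k) (fun k => ε ^ r k * y k) i = ε ^ (μ + r i) * f x y i)
    (m : Fin n → ℝ) (hm : ∀ i, 0 < m i)
    (hfm : ∀ x y : Fin n → ℝ, ∀ i,
      |f x y i| ≤ m i * (hnorm n r p x ^ (μ + r i) + hnorm n r p y ^ (μ + r i)))
    (η : Fin n → Fin n → ℝ) (hη : ∀ i j, 0 < η i j)
    (hfd1 : ∀ i j, 0 ≤ μ + r i - r j → ∀ x y : Fin n → ℝ,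
      |pd n f i j x y| ≤ η i j * (hnorm n r p x ^ (μ + r i - r j) + hnorm n r p y ^ (μ + r i - r j)))
    (hfd2 : ∀ i j, μ + r i - r j < 0 → ∀ x y : Fin n → ℝ, |pd n f i j x y| ≤ η i j)
    (V : (Fin n → ℝ) → ℝ) (hV : ContDiff ℝ 2 V)
    (α0 α1 γ : ℝ) (hα0 : 0 < α0) (hα1 : 0 < α1) (hγ : ∀ i, 2 * r i ≤ γ)
    (hVlb : ∀ x : Fin n → ℝ, α0 * hnorm n r p x ^ γ ≤ V x)
    (hVub : ∀ x : Fin n → ℝ, V x ≤ α1 * hnorm n r p x ^ γ)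
    (β : Fin n → ℝ) (hβ : ∀ i, 0 < β i)
    (hVd : ∀ x : Fin n → ℝ, ∀ i,
      |fderiv ℝ V x (Pi.single i 1)| ≤ β i * hnorm n r p x ^ (γ - r i))
    (ψ : Fin n → Fin n → ℝ) (hψ : ∀ i j, 0 < ψ i j)
    (hVdd : ∀ x : Fin n → ℝ, ∀ i j,
      |fderiv ℝ (fun z => fderiv ℝ V z (Pi.single i 1)) x (Pi.single j 1)|
        ≤ ψ i j * hnorm n r p x ^ (γ - r i - r j))
    (w : ℝ) (hw : 0 < w)
    (hVf : ∀ x : Fin n → ℝ, fderiv ℝ V x (f x x) ≤ -w * hnorm n r p x ^ (γ + μ))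
    (w1 w2 : ℝ) (hw1 : 0 < w1) (hw2 : 0 < w2) (hw0 : 0 < w - w1 - h * w2)
    (χ : ℝ) (hχ : 0 < χ)
    (a2 : ℝ) (ha2def : a2 = w1 - ∑ i, β i * m i * χ ^ (2 * (γ - r i))) (ha2 : 0 < a2)
    (H1 : ℝ) (hH1def : H1 = (α0 / (h * ∑ i, β i * m i * (1 + χ ^ (-2 * (μ + r i))))) ^ (1 / μ))
    (δ : ℝ) (hδ0 : 0 < δ) (hδH1 : δ < H1)
    (L : ℝ) (hLdef : L = ∑ i, ∑ j, m j * (β i * η i j *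
      (if 0 ≤ μ + r i - r j then 1 else δ ^ (r j - r i - μ)) + m i * ψ i j))
    (H2 : ℝ) (hH2def : H2 = (min ((w - w1 - h * w2) / (4 * h * L))
      (min (w1 / (2 * h * L)) (w2 / (2 * L)))) ^ (1 / μ))
    (hδH2 : δ < H2)
    (c0 c2 b1 b2 c b ρ1 ρ2 : ℝ)
    (hc0def : c0 = (w - w1 - h * w2) - 4 * h * L * δ ^ μ)
    (hc2def : c2 = w2 - 2 * L * δ ^ μ)
    (hb1def : b1 = α1 + 2 * h * (∑ i, β i * m i) * δ ^ μ)
    (hb2def : b2 = (w1 + h * w2 + ∑ i, β i * m i) * δ ^ μ)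
    (hcdef : c = min c0 c2) (hbdef : b = max b1 b2)
    (hρ1def : ρ1 = (2 * max 1 h) ^ (μ / γ))
    (hρ2def : ρ2 = c / (ρ1 * b ^ ((γ + μ) / γ)))
    :
    ∀ x : ℝ → Fin n → ℝ, IsSol n h f x →
      (∀ t : ℝ, 0 ≤ t → ∀ θ ∈ Set.Icc (-h) (0:ℝ), hnorm n r p (x (t + θ)) ≤ δ) →
      ∀ t : ℝ, 0 ≤ t →
      ∃ D : ℝ, HasDerivWithinAt (fun τ => vfun n r p h μ γ w1 w2 f V (fun θ => x (τ + θ))) D (Set.Ici 0) t ∧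
        D ≤ -ρ2 * vfun n r p h μ γ w1 w2 f V (fun θ => x (t + θ)) ^ ((γ + μ) / γ) := by
  intro x ⟨hxc, hxd⟩ hxδ t ht
  have hp0 : 0 < p := by linarith
  have hne : Nonempty (Fin n) := ⟨⟨0, hn⟩⟩
  have hγ0 : 0 < γ := by
    have i : Fin n := Classical.arbitrary _
    linarith [hr i, hγ i]
  have hq : 0 ≤ γ + μ := by linarith
  have hfd : ∀ y, Differentiable ℝ fun x => f x y := fun y =>
    (hf_cd y).differentiable (by norm_num)
  have hfc : ∀ x, Continuous fun y => f x y := fun x => (hf_lip x).continuous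
  obtain ⟨B, hB, hfB⟩ := exists_continuous_fderiv_bound hr hp0 hfd hfd1 hfd2
  have hf := continuous_uncurry_of_fderiv_le hfd hfc hB hfB
  -- extend the solution continuously to the whole line
  set X : ℝ → Fin n → ℝ := fun s => x (max s (-h)) with hX
  have hXx : ∀ s, -h ≤ s → X s = x s := fun s hs => by simp only [hX, max_eq_left hs]
  have hXc : Continuous X :=
    hxc.comp_continuous (continuous_id.max continuous_const) fun s =>
      Set.mem_Ici.2 (le_max_right _ _)
  have hXδ : ∀ τ, 0 ≤ τ → ∀ θ ∈ Set.Icc (-h) (0 : ℝ), hnorm n r p (X (τ + θ)) ≤ δ :=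
    fun τ hτ θ hθ => by
      rw [hXx _ (by linarith [hθ.1])]
      exact hxδ τ hτ θ hθ
  have hv : ∀ τ ∈ Set.Ici (0 : ℝ), vfun n r p h μ γ w1 w2 f V (fun θ => x (τ + θ)) =
      vfun n r p h μ γ w1 w2 f V (fun θ => X (τ + θ)) := fun τ hτ =>
    vfun_congr hh fun θ hθ => (hXx _ (by linarith [hθ.1, Set.mem_Ici.1 hτ])).symm
  have hXd : HasDerivWithinAt X (f (X t) (X (t - h))) (Set.Ici 0) t := by
    rw [hXx t (by linarith), hXx (t - h) (by linarith)]
    exact (hxd t ht).congr (fun s hs => hXx s (by linarith [Set.mem_Ici.1 hs]))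
      (hXx t (by linarith))
  obtain ⟨hint, hderiv⟩ := hasDerivWithinAt_vfun (w1 := w1) (w2 := w2) (γ := γ) (μ := μ) hr hp0 hq
    hfd hf hB hfB hV hXc hXd
  refine ⟨_, hderiv.congr hv (hv t ht), ?_⟩
  rw [hv t ht]
  have hφc : Continuous fun θ => X (t + θ) := hXc.comp (continuous_const.add continuous_id)
  have hXt : hnorm n r p (X t) ≤ δ := by simpa using hXδ t ht 0 ⟨by linarith, le_rfl⟩
  have hXh : hnorm n r p (X (t - h)) ≤ δ := by
    simpa [sub_eq_add_neg] using hXδ t ht (-h) ⟨le_rfl, by linarith⟩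
  have hx0 := hnorm_nonneg (r := r) (p := p) (X t)
  -- consequences of the bounds on `δ`
  have hδμ : 0 < δ ^ μ := Real.rpow_pos_of_pos hδ0 μ
  have hC : 0 < ∑ i, β i * m i * (1 + χ ^ (-2 * (μ + r i))) :=
    Finset.sum_pos (fun i _ => mul_pos (mul_pos (hβ i) (hm i)) (by positivity))
      Finset.univ_nonempty
  have hδ1 : h * (∑ i, β i * m i * (1 + χ ^ (-2 * (μ + r i)))) * δ ^ μ ≤ α0 := by
    have := rpow_lt_of_lt_rpow_one_div hδ0.le hμ (by positivity) (hH1def ▸ hδH1)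
    rw [lt_div_iff₀ (by positivity)] at this
    linarith
  have hL : 0 < L := by
    rw [hLdef]
    refine Finset.sum_pos (fun i _ => Finset.sum_pos (fun j _ => mul_pos (hm j) (add_pos
      (mul_pos (mul_pos (hβ i) (hη i j)) ?_) (mul_pos (hm i) (hψ i j)))) Finset.univ_nonempty)
      Finset.univ_nonempty
    split_ifs <;> positivity
  have hδ2 := rpow_lt_of_lt_rpow_one_div hδ0.le hμ (by positivity) (hH2def ▸ hδH2)
  obtain ⟨hd0, hδ2⟩ := lt_min_iff.1 hδ2
  obtain ⟨hd1, hd2⟩ := lt_min_iff.1 hδ2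
  rw [lt_div_iff₀ (by positivity)] at hd0 hd1 hd2
  have hc : 0 < c := by
    rw [hcdef, hc0def, hc2def]
    exact lt_min (by linarith) (by linarith)
  have hS : 0 ≤ ∑ i, β i * m i := Finset.sum_nonneg fun i _ => (mul_pos (hβ i) (hm i)).le
  have hb : 0 < b := by
    rw [hbdef, hb1def]
    exact lt_max_of_lt_left (by positivity)
  -- bounds on the functional
  set I := ∫ s in t - h..t, hnorm n r p (X s) ^ γ with hI
  set J := ∫ s in t - h..t, hnorm n r p (X s) ^ (γ + μ) with hJ
  have hle : t - h ≤ t := by linarith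
  have hI0 : 0 ≤ I := intervalIntegral.integral_nonneg hle fun s _ =>
    Real.rpow_nonneg (hnorm_nonneg _) _
  have hJ0 : 0 ≤ J := intervalIntegral.integral_nonneg hle fun s _ =>
    Real.rpow_nonneg (hnorm_nonneg _) _
  have hv0 : 0 ≤ vfun n r p h μ γ w1 w2 f V (fun θ => X (t + θ)) :=
    vfun_nonneg hr hp0 hh hμ hγ0 hγ hfc hm hβ hfm hVd hVlb hw2 hχ (by linarith) hδ1 hφc
      (by simpa using hXt)
  have hvb : vfun n r p h μ γ w1 w2 f V (fun θ => X (t + θ)) ≤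
      b * (hnorm n r p (X t) ^ γ + I) := by
    have := vfun_le (V := V) hr hp0 hh hμ hγ0 hγ hfc hm hβ hfm hVd hVub hw1 hw2 hφc (hXδ t ht)
    rw [intervalIntegral.integral_comp_add_left (fun s => hnorm n r p (X s) ^ γ) t, add_zero,
      ← sub_eq_add_neg, ← hb1def, ← hb2def] at this
    have e1 : b1 ≤ b := hbdef ▸ le_max_left _ _
    have e2 : b2 ≤ b := hbdef ▸ le_max_right _ _
    have e3 := mul_le_mul_of_nonneg_right e1 (Real.rpow_nonneg hx0 γ)
    have e4 := mul_le_mul_of_nonneg_right e2 hI0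
    linarith
  have hNc : ∀ e : ℝ, 0 ≤ e → Continuous fun s => hnorm n r p (X s) ^ e := fun e he => by
    have hN := (continuous_hnorm (r := r) hr hp0).comp hXc
    exact hN.rpow_const fun _ => Or.inr he
  have hpow : vfun n r p h μ γ w1 w2 f V (fun θ => X (t + θ)) ^ ((γ + μ) / γ) ≤
      ρ1 * b ^ ((γ + μ) / γ) * (hnorm n r p (X t) ^ (γ + μ) + J) := by
    have hq1 : 1 ≤ (γ + μ) / γ := by
      rw [one_le_div hγ0]
      linarith
    have hpm := add_integral_rpow_le (hNc γ hγ0.le) (fun s => Real.rpow_nonneg (hnorm_nonneg _) _)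
      (a := t) (Real.rpow_nonneg hx0 γ) hh hq1
    have hmul : ∀ s, (hnorm n r p (X s) ^ γ) ^ ((γ + μ) / γ) = hnorm n r p (X s) ^ (γ + μ) :=
      fun s => by rw [← Real.rpow_mul (hnorm_nonneg _), mul_div_cancel₀ _ hγ0.ne']
    simp only [hmul] at hpm
    rw [show (γ + μ) / γ - 1 = μ / γ by field_simp; ring, ← hρ1def] at hpm
    calc _ ≤ (b * (hnorm n r p (X t) ^ γ + I)) ^ ((γ + μ) / γ) :=
          Real.rpow_le_rpow hv0 hvb (by linarith)
      _ = b ^ ((γ + μ) / γ) * (hnorm n r p (X t) ^ γ + I) ^ ((γ + μ) / γ) :=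
          Real.mul_rpow hb.le (add_nonneg (Real.rpow_nonneg hx0 γ) hI0)
      _ ≤ b ^ ((γ + μ) / γ) * (ρ1 * (hnorm n r p (X t) ^ (γ + μ) + J)) := by gcongr
      _ = _ := by ring
  -- bound on the derivative
  have hΛ := integral_le_add_mul_integral (G := fun s => hnorm n r p (X s) ^ (γ + μ))
    (A := L * δ ^ μ * (4 * hnorm n r p (X t) ^ (γ + μ) + 2 * hnorm n r p (X (t - h)) ^ (γ + μ)))
    (B := 2 * L * δ ^ μ) hle hint ((hNc _ hq).intervalIntegrable _ _) fun s hs => by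
      have hXs : hnorm n r p (X s) ≤ δ := by
        simpa using hXδ t ht (s - t) ⟨by linarith [hs.1], by linarith [hs.2]⟩
      have := second_order_terms_le hr hμ hγ0 hγ hfd hm hβ hfm hη hfd1 hfd2 hV hVd hψ hVdd hδ0
        hXt hXs hXh
      rw [← hLdef] at this
      linarith
  rw [sub_sub_cancel] at hΛ
  have hVft := hVf (X t)
  have hxq := Real.rpow_nonneg hx0 (γ + μ)
  have hzq := Real.rpow_nonneg (hnorm_nonneg (r := r) (p := p) (X (t - h))) (γ + μ)
  have hcc0 := mul_le_mul_of_nonneg_right (hcdef ▸ min_le_left c0 c2 : c ≤ c0) hxq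
  have hcc2 := mul_le_mul_of_nonneg_right (hcdef ▸ min_le_right c0 c2 : c ≤ c2) hJ0
  have hcc1 := mul_nonneg (by linarith : 0 ≤ w1 - 2 * h * L * δ ^ μ) hzq
  rw [hc0def] at hcc0
  rw [hc2def] at hcc2
  have hρ1 : 0 < ρ1 := by
    rw [hρ1def]
    positivity
  have hρ : ρ2 * vfun n r p h μ γ w1 w2 f V (fun θ => X (t + θ)) ^ ((γ + μ) / γ) ≤
      c * (hnorm n r p (X t) ^ (γ + μ) + J) := by
    rw [hρ2def, div_mul_eq_mul_div, div_le_iff₀ (by positivity)]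
    calc _ ≤ c * (ρ1 * b ^ ((γ + μ) / γ) * (hnorm n r p (X t) ^ (γ + μ) + J)) := by gcongr
      _ = _ := by ring
  linarith
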